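/- Let n ≥ 2 and k ∈ ℝ, and let M = (a, b; c, d) ∈ SAV(ℝ⊕ℝ^{n−1}). If f : H⁺ → Cl_n is smooth and k-hypermonogenic on H⁺, i.e. Df + k(Qf)′/x_n = 0, then F(x) := (conj(cx+d)/‖cx+d‖^{n+1−k}) · f(M<x>) is also k-hypermonogenic on H⁺, i.e. DF + k(QF)′/x_n = 0 on H⁺. -/

import Mathlib

noncomputable section

open scoped symmDiff

/-- An explicit model of the real Clifford algebra `Cl_n` with generators `e 0, …, e (n-1)`
satisfying `eᵢ eⱼ + eⱼ eᵢ = -2 δᵢⱼ` (the Clifford algebra of the negative definite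
quadratic form on `ℝⁿ`): elements are coordinate functions on the canonical basis
`(e_A)_{A ⊆ {0,…,n-1}}`, where `e_A` is the (increasingly ordered) product of the `e i`, `i ∈ A`. -/
def Cl (n : ℕ) : Type := Finset (Fin n) → ℝ

namespace Cl

variable {n : ℕ}

instance : NormedAddCommGroup (Cl n) :=
  inferInstanceAs (NormedAddCommGroup (Finset (Fin n) → ℝ))

instance : NormedSpace ℝ (Cl n) :=
  inferInstanceAs (NormedSpace ℝ (Finset (Fin n) → ℝ))

/-- The coefficient of `a` at the basis element `e_A`. -/
def coeff (a : Cl n) (A : Finset (Fin n)) : ℝ := a A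

/-- The sign occurring in the product `e_A * e_B = mulSign A B • e_{A ∆ B}`,
coming from the relations `eᵢ eⱼ = -eⱼ eᵢ` (i ≠ j) and `eᵢ² = -1`. -/
def mulSign (A B : Finset (Fin n)) : ℝ :=
  (-1 : ℝ) ^ (((A ×ˢ B).filter fun p => p.2 < p.1).card + (A ∩ B).card)

/-- Clifford multiplication. -/
def mul (a b : Cl n) : Cl n := fun C =>
  ∑ A : Finset (Fin n), ∑ B : Finset (Fin n),
    if A ∆ B = C then mulSign A B * a A * b B else 0

/-- The unit `1` of the Clifford algebra. -/
def one : Cl n := Pi.single ∅ 1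

/-- The embedding of the real scalars. -/
def scalar (r : ℝ) : Cl n := Pi.single ∅ r

/-- The generators `e i` (in the paper: `e_1, …, e_n`). -/
def e (i : Fin n) : Cl n := Pi.single {i} 1

/-- Reversion: the anti-automorphism fixing all the `e i`. -/
def reverse (a : Cl n) : Cl n := fun A => (-1 : ℝ) ^ (A.card * (A.card - 1) / 2) * a A

/-- The main involution `′`: the automorphism with `(e i)′ = - e i`. -/
def involute (a : Cl n) : Cl n := fun A => (-1 : ℝ) ^ A.card * a A

/-- Clifford conjugation: the anti-automorphism with `conj (e i) = - e i`
(the composite of reversion and the main involution). -/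
def conj (a : Cl n) : Cl n := fun A => (-1 : ℝ) ^ (A.card * (A.card + 1) / 2) * a A

/-- The norm on `Cl n`: the square root of the sum of the squares of the
coordinates in the standard basis. -/
def norm (a : Cl n) : ℝ := Real.sqrt (∑ A : Finset (Fin n), a A ^ 2)

/-- Invertibility in the Clifford algebra. -/
def IsInvertible (a : Cl n) : Prop := ∃ b, mul a b = one ∧ mul b a = one

/-- The inverse of an invertible Clifford number (junk value `0` otherwise). -/
def inv (a : Cl n) : Cl n :=
  letI := Classical.propDecidable (IsInvertible a)
  if h : IsInvertible a then h.choose else 0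

/-- The paravector `x₀ + x₁ e₁ + ⋯ + xₙ eₙ` attached to `x ∈ ℝ^{n+1}`. -/
def para (x : Fin (n + 1) → ℝ) : Cl n :=
  scalar (x 0) + ∑ i : Fin n, x i.succ • e i

/-- Being a paravector. -/
def IsParavector (a : Cl n) : Prop := ∃ x : Fin (n + 1) → ℝ, a = para x

/-- The coordinates in `ℝ^{n+1}` of (the paravector part of) a Clifford number. -/
def paraCoord (a : Cl n) : Fin (n + 1) → ℝ :=
  Fin.cases (coeff a ∅) (fun i => coeff a {i})

/-- Being a (possibly empty) product of nonzero paravectors. -/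
def IsProdOfParavectors (a : Cl n) : Prop :=
  ∃ l : List (Fin (n + 1) → ℝ), (∀ x ∈ l, x ≠ 0) ∧
    a = l.foldr (fun x b => mul (para x) b) one

/-- The special Ahlfors–Vahlen group `SAV(ℝ ⊕ ℝⁿ)`: 2×2 matrices `(a b; c d)` with entries
in `Cl n` such that each entry is `0` or a product of nonzero paravectors,
`a ⬝ reverse d - b ⬝ reverse c = 1`, and `a c⁻¹, c⁻¹ d` are paravectors if `c ≠ 0`
resp. `b d⁻¹` is a paravector if `c = 0`. -/
structure SAV (n : ℕ) where
  a : Cl n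
  b : Cl n
  c : Cl n
  d : Cl n
  prod_a : a = 0 ∨ IsProdOfParavectors a
  prod_b : b = 0 ∨ IsProdOfParavectors b
  prod_c : c = 0 ∨ IsProdOfParavectors c
  prod_d : d = 0 ∨ IsProdOfParavectors d
  det : mul a (reverse d) - mul b (reverse c) = one
  cond_c : c ≠ 0 → IsParavector (mul a (inv c)) ∧ IsParavector (mul (inv c) d)
  cond_c0 : c = 0 → IsParavector (mul b (inv d))

/-- The Clifford number `c x + d` attached to a matrix `M` and `x ∈ ℝ^{n+1}`. -/
def cxd (M : SAV n) (x : Fin (n + 1) → ℝ) : Cl n := mul M.c (para x) + M.d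

/-- The numerator `a x + b`. -/
def axb (M : SAV n) (x : Fin (n + 1) → ℝ) : Cl n := mul M.a (para x) + M.b

/-- The Möbius transformation `M<x> = (ax+b)(cx+d)⁻¹` as a Clifford number. -/
def moebiusCl (M : SAV n) (x : Fin (n + 1) → ℝ) : Cl n := mul (axb M x) (inv (cxd M x))

/-- The Möbius transformation `M<x>` as a point of `ℝ^{n+1}`. -/
def moebius (M : SAV n) (x : Fin (n + 1) → ℝ) : Fin (n + 1) → ℝ :=
  paraCoord (moebiusCl M x)

/-- `a` lies in the subalgebra `Cl_{n-1}` generated by the `e j` with `j ≠ i`. -/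
def memSub (a : Cl n) (i : Fin n) : Prop := ∀ A : Finset (Fin n), i ∈ A → coeff a A = 0

/-- The subgroup `SAV(ℝ ⊕ ℝ^{m})` of `SAV(ℝ ⊕ ℝ^{m+1})` of matrices whose entries lie
in the subalgebra `Cl_m ⊆ Cl_{m+1}`. -/
structure SAVsub (m : ℕ) extends SAV (m + 1) where
  sub_a : memSub a (Fin.last m)
  sub_b : memSub b (Fin.last m)
  sub_c : memSub c (Fin.last m)
  sub_d : memSub d (Fin.last m)

/-- The `P`-part of `a ∈ Cl_{m+1} = Cl_m ⊕ Cl_m e_{top}`: `a = P a + (Q a) e_top`. -/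
def Ppart {m : ℕ} (a : Cl (m + 1)) : Cl (m + 1) := fun A =>
  if Fin.last m ∈ A then 0 else a A

/-- The `Q`-part of `a ∈ Cl_{m+1} = Cl_m ⊕ Cl_m e_{top}`: `a = P a + (Q a) e_top`. -/
def Qpart {m : ℕ} (a : Cl (m + 1)) : Cl (m + 1) := fun A =>
  if Fin.last m ∈ A then 0 else a (insert (Fin.last m) A)

/-- Partial derivative `∂f/∂xᵢ`. -/
def pderiv {E : Type*} [NormedAddCommGroup E] [NormedSpace ℝ E] {m : ℕ}
    (i : Fin m) (f : (Fin m → ℝ) → E) (x : Fin m → ℝ) : E :=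
  fderiv ℝ f x (Pi.single i 1)

/-- The Euclidean Laplacian `Δ = Σᵢ ∂²/∂xᵢ²` (acting componentwise). -/
def lap {E : Type*} [NormedAddCommGroup E] [NormedSpace ℝ E] {m : ℕ}
    (f : (Fin m → ℝ) → E) : (Fin m → ℝ) → E :=
  fun x => ∑ i : Fin m, pderiv i (pderiv i f) x

/-- The Euclidean Dirac operator `D f = ∂f/∂x₀ + Σᵢ eᵢ ∂f/∂xᵢ`. -/
def dirac (f : (Fin (n + 1) → ℝ) → Cl n) : (Fin (n + 1) → ℝ) → Cl n :=
  fun x => pderiv 0 f x + ∑ i : Fin n, mul (e i) (pderiv i.succ f x)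

/-- Upper half-space `H⁺ = {x ∈ ℝ^{n+1} : xₙ > 0}`. -/
def upperHalf (n : ℕ) : Set (Fin (n + 1) → ℝ) := {x | 0 < x (Fin.last n)}

/-- The Euclidean norm on `ℝ^m`. -/
def enorm {m : ℕ} (x : Fin m → ℝ) : ℝ := Real.sqrt (∑ i, x i ^ 2)

end Cl

namespace Cl

variable {n : ℕ}

/-! ### The ring structure -/

section Sign

/-- The sign by which `e i` and `e j` contribute to `mulSign`. -/
def pairSign (i j : Fin n) : ℝ := if j ≤ i then -1 else 1

theorem pairSign_mul_self (i j : Fin n) : pairSign i j * pairSign i j = 1 := by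
  unfold pairSign; split_ifs <;> norm_num

theorem mulSign_eq_prod (A B : Finset (Fin n)) :
    mulSign A B = ∏ i ∈ A, ∏ j ∈ B, pairSign i j := by
  have h : ((A ×ˢ B).filter fun p => p.2 < p.1).card + (A ∩ B).card =
      ((A ×ˢ B).filter fun p => p.2 ≤ p.1).card := by
    have h2 : (A ∩ B).card = ((A ×ˢ B).filter fun p => p.2 = p.1).card := by
      apply Finset.card_bij (fun a _ => (a, a))
      · intro a ha; simpa using ha
      · intro a _ b _ hab; simpa using hab
      · rintro ⟨a, b⟩ h
        simp only [Finset.mem_filter, Finset.mem_product] at h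
        obtain ⟨⟨h1, h2⟩, rfl⟩ := h
        exact ⟨b, by simp [h1, h2], rfl⟩
    rw [h2, ← Finset.card_union_of_disjoint, ← Finset.filter_or]
    · simp only [le_iff_lt_or_eq]
    · exact Finset.disjoint_filter.2 fun p _ h1 h2 => h1.ne h2
  rw [mulSign, h, ← Finset.prod_product', ← Finset.prod_const, Finset.prod_filter]
  rfl

theorem prod_symmDiff {ι : Type*} [DecidableEq ι] (g : ι → ℝ) (hg : ∀ i, g i * g i = 1)
    (A B : Finset ι) : ∏ i ∈ A ∆ B, g i = (∏ i ∈ A, g i) * ∏ i ∈ B, g i := by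
  have hd : Disjoint (A \ B) (B \ A) := disjoint_sdiff_sdiff
  have hA : (∏ i ∈ A \ B, g i) * ∏ i ∈ A ∩ B, g i = ∏ i ∈ A, g i := by
    rw [mul_comm]; exact Finset.prod_inter_mul_prod_sdiff A B g
  have hB : (∏ i ∈ B \ A, g i) * ∏ i ∈ A ∩ B, g i = ∏ i ∈ B, g i := by
    rw [mul_comm, Finset.inter_comm]; exact Finset.prod_inter_mul_prod_sdiff B A g
  have hI : (∏ i ∈ A ∩ B, g i) * ∏ i ∈ A ∩ B, g i = 1 := by
    rw [← Finset.prod_mul_distrib]; exact Finset.prod_eq_one fun i _ => hg i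
  have : A ∆ B = (A \ B) ∪ (B \ A) := rfl
  rw [this, Finset.prod_union hd, ← hA, ← hB]
  linear_combination (-(∏ i ∈ A \ B, g i) * ∏ i ∈ B \ A, g i) * hI

theorem mulSign_symmDiff_left (A B C : Finset (Fin n)) :
    mulSign (A ∆ B) C = mulSign A C * mulSign B C := by
  simp only [mulSign_eq_prod]
  refine prod_symmDiff (fun i => ∏ j ∈ C, pairSign i j) (fun i => ?_) A B
  rw [← Finset.prod_mul_distrib]
  exact Finset.prod_eq_one fun j _ => pairSign_mul_self i j

theorem mulSign_symmDiff_right (A B C : Finset (Fin n)) :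
    mulSign A (B ∆ C) = mulSign A B * mulSign A C := by
  simp only [mulSign_eq_prod]
  rw [← Finset.prod_mul_distrib]
  exact Finset.prod_congr rfl fun i _ => prod_symmDiff _ (pairSign_mul_self i) B C

theorem mulSign_mul_self (A B : Finset (Fin n)) : mulSign A B * mulSign A B = 1 := by
  rw [mulSign, ← mul_pow]; norm_num

@[simp] theorem mulSign_empty_left (A : Finset (Fin n)) : mulSign ∅ A = 1 := by
  simp [mulSign_eq_prod]

@[simp] theorem mulSign_empty_right (A : Finset (Fin n)) : mulSign A ∅ = 1 := by
  simp [mulSign_eq_prod]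

theorem mulSign_self (A : Finset (Fin n)) :
    mulSign A A = (-1) ^ (A.card * (A.card + 1) / 2) := by
  induction A using Finset.induction_on with
  | empty => simp
  | insert x A hx ih =>
    have hxA : insert x A = {x} ∆ A := by
      rw [Disjoint.symmDiff_eq_sup (by simpa using hx)]; rfl
    have h1 : mulSign {x} {x} = -1 := by simp [mulSign_eq_prod, pairSign]
    have h2 : mulSign {x} A * mulSign A {x} = (-1) ^ A.card := by
      rw [mulSign_eq_prod, mulSign_eq_prod]
      simp only [Finset.prod_singleton]
      rw [← Finset.prod_mul_distrib, ← Finset.prod_const]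
      refine Finset.prod_congr rfl fun i hi => ?_
      have : i ≠ x := fun h => hx (h ▸ hi)
      rcases lt_or_gt_of_ne this with h | h <;> simp [pairSign, h.le, h.not_ge]
    have h3 : (A.card + 1) * (A.card + 1 + 1) / 2 = A.card * (A.card + 1) / 2 + (A.card + 1) := by
      rw [show (A.card + 1) * (A.card + 1 + 1) = A.card * (A.card + 1) + (A.card + 1) * 2 by ring]
      exact Nat.add_mul_div_right _ _ two_pos
    rw [Finset.card_insert_of_notMem hx, h3, pow_add, ← ih, pow_succ, ← h2, hxA,
      mulSign_symmDiff_left, mulSign_symmDiff_right, mulSign_symmDiff_right, h1]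
    ring

end Sign

theorem ext {a b : Cl n} (h : ∀ A, a A = b A) : a = b := funext h

@[simp] theorem add_coord (a b : Cl n) (A : Finset (Fin n)) : (a + b) A = a A + b A := rfl
@[simp] theorem neg_coord (a : Cl n) (A : Finset (Fin n)) : (-a) A = -a A := rfl
@[simp] theorem zero_coord (A : Finset (Fin n)) : (0 : Cl n) A = 0 := rfl
@[simp] theorem smul_coord (r : ℝ) (a : Cl n) (A : Finset (Fin n)) : (r • a) A = r * a A := rfl
@[simp] theorem sum_coord {ι : Type*} (s : Finset ι) (g : ι → Cl n) (A : Finset (Fin n)) :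
    (∑ i ∈ s, g i) A = ∑ i ∈ s, g i A :=
  Finset.sum_apply A s g

theorem mul_coord (a b : Cl n) (C : Finset (Fin n)) :
    mul a b C = ∑ A, mulSign A (A ∆ C) * a A * b (A ∆ C) := by
  refine Finset.sum_congr rfl fun A _ => ?_
  rw [Finset.sum_eq_single (A ∆ C)]
  · simp
  · intro B _ hB
    rw [if_neg]
    rintro rfl
    simp at hB
  · simp

theorem mul_coord_right (a b : Cl n) (C : Finset (Fin n)) :
    mul a b C = ∑ B, mulSign (C ∆ B) B * a (C ∆ B) * b B := by
  rw [mul_coord]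
  refine Finset.sum_bij' (fun A _ => A ∆ C) (fun B _ => C ∆ B) ?_ ?_ ?_ ?_ ?_
  · simp
  · simp
  · intro A _; rw [symmDiff_comm A C]; simp
  · intro A _; rw [symmDiff_comm C A]; simp
  · intro A _; rw [symmDiff_comm A C]; simp

scoped instance : Ring (Cl n) :=
  { (inferInstance : AddCommGroup (Cl n)) with
    mul := mul
    one := one
    left_distrib := fun a b c => ext fun C => by
      change mul a (b + c) C = mul a b C + mul a c C
      simp only [mul_coord, add_coord, mul_add, Finset.sum_add_distrib]
    right_distrib := fun a b c => ext fun C => by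
      change mul (a + b) c C = mul a c C + mul b c C
      simp only [mul_coord, add_coord, mul_add, add_mul, Finset.sum_add_distrib]
    zero_mul := fun a => ext fun C => by
      change mul 0 a C = 0
      simp [mul_coord]
    mul_zero := fun a => ext fun C => by
      change mul a 0 C = 0
      simp [mul_coord]
    one_mul := fun a => ext fun C => by
      change mul one a C = a C
      rw [mul_coord, Finset.sum_eq_single ∅]
      · rw [show ∅ ∆ C = C from bot_symmDiff C]
        simp [one]
      · intro A _ hA
        simp [one, Pi.single_eq_of_ne hA]
      · simp
    mul_one := fun a => ext fun C => by
      change mul a one C = a C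
      rw [mul_coord_right, Finset.sum_eq_single ∅]
      · rw [show C ∆ ∅ = C from symmDiff_bot C]
        simp [one]
      · intro A _ hA
        simp [one, Pi.single_eq_of_ne hA]
      · simp
    mul_assoc := fun a b c => ext fun D => by
      change mul (mul a b) c D = mul a (mul b c) D
      rw [mul_coord_right, mul_coord]
      simp only [mul_coord a b, mul_coord_right b c, Finset.mul_sum, Finset.sum_mul]
      rw [Finset.sum_comm]
      refine Finset.sum_congr rfl fun A _ => Finset.sum_congr rfl fun C _ => ?_
      rw [symmDiff_assoc A D C]
      simp only [mulSign_symmDiff_left, mulSign_symmDiff_right]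
      ring }

theorem mul_eq (a b : Cl n) : mul a b = a * b := rfl

theorem one_eq : (one : Cl n) = 1 := rfl

scoped instance : Algebra ℝ (Cl n) :=
  Algebra.ofModule
    (fun r a b => ext fun C => by
      change mul (r • a) b C = r * mul a b C
      simp only [mul_coord, smul_coord, Finset.mul_sum]
      exact Finset.sum_congr rfl fun A _ => by ring)
    (fun r a b => ext fun C => by
      change mul a (r • b) C = r * mul a b C
      simp only [mul_coord, smul_coord, Finset.mul_sum]
      exact Finset.sum_congr rfl fun A _ => by ring)

scoped instance : FiniteDimensional ℝ (Cl n) :=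
  inferInstanceAs (FiniteDimensional ℝ (Finset (Fin n) → ℝ))

theorem scalar_eq (r : ℝ) : (scalar r : Cl n) = r • 1 := by
  refine ext fun A => ?_
  rw [smul_coord, ← one_eq, one, scalar]
  by_cases h : A = ∅
  · subst h; simp
  · simp [Pi.single_eq_of_ne h]

theorem one_coord_empty : (1 : Cl n) ∅ = 1 := by
  rw [← one_eq, one, Pi.single_eq_same]

/-! ### Conjugation, main involution and reversion -/

theorem conj_coord (a : Cl n) (A : Finset (Fin n)) : conj a A = mulSign A A * a A := by
  rw [mulSign_self]; rfl

theorem conj_conj (a : Cl n) : conj (conj a) = a := ext fun A => by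
  rw [conj_coord, conj_coord, ← mul_assoc, mulSign_mul_self, one_mul]

theorem conj_mul (a b : Cl n) : conj (a * b) = conj b * conj a := ext fun C => by
  change conj (mul a b) C = mul (conj b) (conj a) C
  rw [conj_coord, mul_coord, mul_coord_right, Finset.mul_sum]
  refine Finset.sum_congr rfl fun A _ => ?_
  rw [conj_coord, conj_coord, symmDiff_comm C A]
  simp only [mulSign_symmDiff_left, mulSign_symmDiff_right]
  linear_combination
    (-(mulSign C C * mulSign A A * mulSign A C * a A * b (A ∆ C)) * mulSign C A ^ 2) *
      mulSign_mul_self A A -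
    mulSign C C * mulSign A A * mulSign A C * a A * b (A ∆ C) * mulSign_mul_self C A

/-- Clifford conjugation as a linear map. -/
def conjₗ : Cl n →ₗ[ℝ] Cl n where
  toFun := conj
  map_add' a b := ext fun A => by simp only [conj_coord, add_coord, mul_add]
  map_smul' r a := ext fun A => by
    simp only [conj_coord, smul_coord, RingHom.id_apply]; ring

theorem conj_add (a b : Cl n) : conj (a + b) = conj a + conj b := conjₗ.map_add a b
theorem conj_smul (r : ℝ) (a : Cl n) : conj (r • a) = r • conj a := conjₗ.map_smul r a
theorem conj_sub (a b : Cl n) : conj (a - b) = conj a - conj b := conjₗ.map_sub a b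

theorem conj_one : conj (1 : Cl n) = 1 := by
  have h := conj_mul (conj (1 : Cl n)) 1
  rw [mul_one, conj_conj, mul_one] at h
  exact h.symm

theorem neg_one_pow_card_symmDiff (A B : Finset (Fin n)) :
    (-1 : ℝ) ^ (A ∆ B).card = (-1) ^ A.card * (-1) ^ B.card := by
  simp only [← Finset.prod_const]
  exact prod_symmDiff (fun _ => (-1 : ℝ)) (fun _ => by norm_num) A B

theorem involute_involute (a : Cl n) : involute (involute a) = a := ext fun A => by
  change (-1 : ℝ) ^ A.card * ((-1 : ℝ) ^ A.card * a A) = a A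
  rw [← mul_assoc, ← mul_pow]; norm_num

theorem involute_mul (a b : Cl n) : involute (a * b) = involute a * involute b :=
  ext fun C => by
    change (-1 : ℝ) ^ C.card * mul a b C = mul (involute a) (involute b) C
    rw [mul_coord, mul_coord, Finset.mul_sum]
    refine Finset.sum_congr rfl fun A _ => ?_
    change _ = _ * ((-1 : ℝ) ^ A.card * a A) * ((-1 : ℝ) ^ (A ∆ C).card * b (A ∆ C))
    rw [neg_one_pow_card_symmDiff]
    have h : (-1 : ℝ) ^ A.card * (-1 : ℝ) ^ A.card = 1 := by rw [← mul_pow]; norm_num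
    linear_combination (-(-1 : ℝ) ^ C.card * mulSign A (A ∆ C) * a A * b (A ∆ C)) * h

/-- The main involution as a linear map. -/
def involuteₗ : Cl n →ₗ[ℝ] Cl n where
  toFun := involute
  map_add' a b := ext fun A => mul_add ((-1 : ℝ) ^ A.card) (a A) (b A)
  map_smul' r a := ext fun A => mul_left_comm ((-1 : ℝ) ^ A.card) r (a A)

theorem involute_add (a b : Cl n) : involute (a + b) = involute a + involute b :=
  involuteₗ.map_add a b
theorem involute_sub (a b : Cl n) : involute (a - b) = involute a - involute b :=
  involuteₗ.map_sub a b
theorem involute_smul (r : ℝ) (a : Cl n) : involute (r • a) = r • involute a :=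
  involuteₗ.map_smul r a

theorem reverse_eq (a : Cl n) : reverse a = conj (involute a) := ext fun A => by
  change (-1 : ℝ) ^ (A.card * (A.card - 1) / 2) * a A =
    (-1 : ℝ) ^ (A.card * (A.card + 1) / 2) * ((-1 : ℝ) ^ A.card * a A)
  have h : A.card * (A.card + 1) / 2 = A.card * (A.card - 1) / 2 + A.card := by
    rcases A.card with _ | k
    · simp
    · rw [Nat.add_sub_cancel, show (k + 1) * (k + 1 + 1) = (k + 1) * k + (k + 1) * 2 by ring]
      exact Nat.add_mul_div_right _ _ two_pos
  have h1 : (-1 : ℝ) ^ A.card * (-1 : ℝ) ^ A.card = 1 := by rw [← mul_pow]; norm_num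
  rw [h, pow_add]
  linear_combination (-(-1 : ℝ) ^ (A.card * (A.card - 1) / 2) * a A) * h1

theorem involute_conj (a : Cl n) : involute (conj a) = conj (involute a) := ext fun A =>
  mul_left_comm ((-1 : ℝ) ^ A.card) ((-1 : ℝ) ^ (A.card * (A.card + 1) / 2)) (a A)

theorem reverse_mul (a b : Cl n) : reverse (a * b) = reverse b * reverse a := by
  simp only [reverse_eq, involute_mul, conj_mul]

theorem reverse_add (a b : Cl n) : reverse (a + b) = reverse a + reverse b := by
  simp only [reverse_eq, involute_add, conj_add]

theorem reverse_sub (a b : Cl n) : reverse (a - b) = reverse a - reverse b := by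
  simp only [reverse_eq, involute_sub, conj_sub]

theorem involute_reverse (a : Cl n) : involute (reverse a) = conj a := by
  rw [reverse_eq, involute_conj, involute_involute]

theorem conj_reverse (a : Cl n) : conj (reverse a) = involute a := by
  rw [reverse_eq, conj_conj]

theorem reverse_involute (a : Cl n) : reverse (involute a) = conj a := by
  rw [reverse_eq, involute_involute]

theorem involute_one : involute (1 : Cl n) = 1 := by
  have h := involute_mul (involute (1 : Cl n)) 1
  rw [mul_one, involute_involute, one_mul] at h
  exact h.symm

theorem reverse_one : reverse (1 : Cl n) = 1 := by
  rw [reverse_eq, involute_one, conj_one]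

/-! ### The scalar part and the norm -/

/-- The square of the norm. -/
def normSq (a : Cl n) : ℝ := ∑ A : Finset (Fin n), a A ^ 2

theorem normSq_nonneg (a : Cl n) : 0 ≤ normSq a := Finset.sum_nonneg fun _ _ => sq_nonneg _

theorem normSq_pos {a : Cl n} (ha : a ≠ 0) : 0 < normSq a := by
  refine (normSq_nonneg a).lt_of_ne fun h => ha (ext fun A => ?_)
  have := (Finset.sum_eq_zero_iff_of_nonneg fun A _ => sq_nonneg (a A)).1 h.symm A
    (Finset.mem_univ A)
  simpa using this

theorem mul_coord_empty (a b : Cl n) : (a * b) ∅ = ∑ A, mulSign A A * (a A * b A) := by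
  change mul a b ∅ = _
  rw [mul_coord]
  refine Finset.sum_congr rfl fun A _ => ?_
  rw [show A ∆ ∅ = A from symmDiff_bot A, mul_assoc]

theorem mul_coord_empty_comm (a b : Cl n) : (a * b) ∅ = (b * a) ∅ := by
  simp only [mul_coord_empty, mul_comm (a _)]

theorem conj_coord_empty (a : Cl n) : conj a ∅ = a ∅ := by
  rw [conj_coord, mulSign_empty_left, one_mul]

theorem mul_conj_coord_empty (a : Cl n) : (a * conj a) ∅ = normSq a := by
  rw [mul_coord_empty]
  refine Finset.sum_congr rfl fun A _ => ?_
  rw [conj_coord]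
  linear_combination a A ^ 2 * mulSign_mul_self A A

/-! ### Paravectors -/

/-- The basis `1, e 0, …, e (n - 1)` of the space of paravectors. -/
def basisVec (i : Fin (n + 1)) : Cl n := Fin.cases 1 e i

@[simp] theorem basisVec_zero : (basisVec 0 : Cl n) = 1 := rfl
@[simp] theorem basisVec_succ (i : Fin n) : basisVec i.succ = e i := rfl

theorem para_eq_sum (x : Fin (n + 1) → ℝ) : para x = ∑ i, x i • basisVec i := by
  rw [Fin.sum_univ_succ, para, scalar_eq]; rfl

/-- `para` as a linear map. -/
def paraₗ : (Fin (n + 1) → ℝ) →ₗ[ℝ] Cl n where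
  toFun := para
  map_add' x y := by
    simp only [para_eq_sum, Pi.add_apply, add_smul, Finset.sum_add_distrib]
  map_smul' r x := by
    simp only [para_eq_sum, Pi.smul_apply, smul_eq_mul, mul_smul, Finset.smul_sum,
      RingHom.id_apply]

theorem para_add (x y : Fin (n + 1) → ℝ) : para (x + y) = para x + para y := paraₗ.map_add x y
theorem para_sub (x y : Fin (n + 1) → ℝ) : para (x - y) = para x - para y := paraₗ.map_sub x y
theorem para_smul (r : ℝ) (x : Fin (n + 1) → ℝ) : para (r • x) = r • para x :=
  paraₗ.map_smul r x
theorem para_zero : para (0 : Fin (n + 1) → ℝ) = 0 := paraₗ.map_zero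

theorem para_single (i : Fin (n + 1)) : para (Pi.single i (1 : ℝ)) = basisVec i := by
  rw [para_eq_sum, Finset.sum_eq_single i]
  · simp
  · intro j _ hj; simp [hj]
  · simp

theorem e_coord (i : Fin n) (A : Finset (Fin n)) : e i A = if A = {i} then 1 else 0 := by
  rw [e, Pi.single_apply]

theorem one_coord (A : Finset (Fin n)) : (1 : Cl n) A = if A = ∅ then 1 else 0 := by
  rw [← one_eq, one, Pi.single_apply]

theorem para_coord_empty (x : Fin (n + 1) → ℝ) : para x ∅ = x 0 := by
  rw [para, scalar_eq]
  simp [one_coord, e_coord, (Finset.singleton_ne_empty _).symm]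

theorem para_coord_singleton (x : Fin (n + 1) → ℝ) (i : Fin n) : para x {i} = x i.succ := by
  rw [para, scalar_eq]
  simp [one_coord, e_coord]

theorem paraCoord_para (x : Fin (n + 1) → ℝ) : paraCoord (para x) = x := by
  funext i
  refine Fin.cases ?_ (fun i => ?_) i
  · exact para_coord_empty x
  · exact para_coord_singleton x i

theorem e_mul_coord (i : Fin n) (a : Cl n) (C : Finset (Fin n)) :
    (e i * a) C = mulSign {i} ({i} ∆ C) * a ({i} ∆ C) := by
  change mul (e i) a C = _
  rw [mul_coord, Finset.sum_eq_single {i}]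
  · simp [e_coord]
  · intro A _ hA; simp [e_coord, hA]
  · simp

theorem mul_e_coord (i : Fin n) (a : Cl n) (C : Finset (Fin n)) :
    (a * e i) C = mulSign (C ∆ {i}) {i} * a (C ∆ {i}) := by
  change mul a (e i) C = _
  rw [mul_coord_right, Finset.sum_eq_single {i}]
  · simp [e_coord]
  · intro A _ hA; simp [e_coord, hA]
  · simp

theorem e_mul_e_self (i : Fin n) : e i * e i = -1 := ext fun C => by
  rw [e_mul_coord, neg_coord, one_coord, e_coord]
  by_cases h : C = ∅
  · subst h
    rw [show ({i} : Finset (Fin n)) ∆ ∅ = {i} from symmDiff_bot _]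
    simp [mulSign_eq_prod, pairSign]
  · have : ¬ ({i} : Finset (Fin n)) ∆ C = {i} := fun h' => h (symmDiff_eq_left.1 h')
    simp [h, this]

theorem e_mul_e_of_ne {i j : Fin n} (hij : i ≠ j) : e i * e j = -(e j * e i) := ext fun C => by
  rw [neg_coord, e_mul_coord, mul_e_coord, e_coord, e_coord, symmDiff_comm]
  by_cases h : C ∆ {i} = {j}
  · have hs : pairSign i j = -pairSign j i := by
      rcases lt_or_gt_of_ne hij with h | h <;> simp [pairSign, h.le, h.not_ge]
    simp [h, mulSign_eq_prod, hs]
  · simp [h]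

theorem conj_e (i : Fin n) : conj (e i) = -e i := ext fun A => by
  rw [conj_coord, neg_coord, e_coord]
  by_cases h : A = {i}
  · subst h; simp [mulSign_eq_prod, pairSign]
  · simp [h]

theorem involute_e (i : Fin n) : involute (e i) = -e i := ext fun A => by
  change (-1 : ℝ) ^ A.card * e i A = _
  rw [neg_coord, e_coord]
  by_cases h : A = {i}
  · subst h; simp
  · simp [h]

theorem reverse_e (i : Fin n) : reverse (e i) = e i := by
  rw [reverse_eq, involute_e, ← neg_one_smul ℝ (e i), conj_smul, conj_e]
  simp

theorem basisVec_mul_conj_add (i j : Fin (n + 1)) :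
    basisVec i * conj (basisVec j) + basisVec j * conj (basisVec i : Cl n) =
      (if i = j then (2 : ℝ) else 0) • 1 := by
  refine Fin.cases ?_ (fun i => ?_) i <;> refine Fin.cases ?_ (fun j => ?_) j
  · simp [conj_one, two_smul]
  · simp [conj_one, conj_e, (Fin.succ_ne_zero _).symm]
  · simp [conj_one, conj_e, Fin.succ_ne_zero]
  · by_cases h : i = j
    · subst h
      simp [conj_e, e_mul_e_self, two_smul]
    · simp [conj_e, e_mul_e_of_ne h, h]

theorem conj_para_eq_sum (x : Fin (n + 1) → ℝ) :
    conj (para x) = ∑ i, x i • conj (basisVec i) := by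
  rw [para_eq_sum]
  change conjₗ _ = ∑ i, x i • conjₗ (basisVec i)
  simp

theorem para_mul_conj_add (x y : Fin (n + 1) → ℝ) :
    para x * conj (para y) + para y * conj (para x) = (2 * ∑ i, x i * y i) • (1 : Cl n) := by
  rw [conj_para_eq_sum, conj_para_eq_sum, para_eq_sum, para_eq_sum, Finset.sum_mul_sum,
    Finset.sum_mul_sum, Finset.sum_comm (s := Finset.univ (α := Fin (n + 1)))
      (f := fun i j => y i • basisVec i * x j • conj (basisVec j)), ← Finset.sum_add_distrib,
    Finset.mul_sum, Finset.sum_smul]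
  refine Finset.sum_congr rfl fun i _ => ?_
  rw [← Finset.sum_add_distrib]
  have : ∀ j, x i • basisVec i * y j • conj (basisVec j) +
      y j • basisVec j * x i • conj (basisVec i) =
      (x i * y j * if i = j then (2 : ℝ) else 0) • (1 : Cl n) := fun j => by
    rw [mul_smul (x i * y j), ← basisVec_mul_conj_add, smul_add]
    simp only [smul_mul_smul_comm, mul_comm]
  rw [Finset.sum_congr rfl fun j _ => this j, ← Finset.sum_smul]
  simp; ring_nf

theorem para_mul_conj (x : Fin (n + 1) → ℝ) :
    para x * conj (para x) = (∑ i, x i ^ 2) • (1 : Cl n) := by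
  have h := para_mul_conj_add x x
  rw [← two_smul ℝ (para x * _), mul_smul] at h
  have := smul_right_injective (Cl n) (two_ne_zero (α := ℝ)) h
  simpa only [sq] using this

/-- The coordinates of the conjugate of a paravector. -/
def conjVec (x : Fin (n + 1) → ℝ) : Fin (n + 1) → ℝ := Fin.cases (x 0) fun i => -x i.succ

theorem conj_para (x : Fin (n + 1) → ℝ) : conj (para x) = para (conjVec x) := by
  rw [conj_para_eq_sum, para_eq_sum, Fin.sum_univ_succ, Fin.sum_univ_succ]
  simp [conjVec, conj_one, conj_e]

theorem conjVec_conjVec (x : Fin (n + 1) → ℝ) : conjVec (conjVec x) = x := by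
  funext i; refine Fin.cases ?_ (fun i => ?_) i <;> simp [conjVec]

theorem conj_mul_para (x : Fin (n + 1) → ℝ) :
    conj (para x) * para x = (∑ i, x i ^ 2) • (1 : Cl n) := by
  have h := para_mul_conj (conjVec x)
  rw [conj_para, conjVec_conjVec, ← conj_para] at h
  rw [h, Fin.sum_univ_succ, Fin.sum_univ_succ]
  simp [conjVec]

theorem reverse_para (x : Fin (n + 1) → ℝ) : reverse (para x) = para x := by
  have h : reverse (para x) = ∑ i, x i • reverse (basisVec i) := by
    rw [para_eq_sum]
    simp only [reverse_eq]
    change (conjₗ ∘ₗ involuteₗ) _ = ∑ i, x i • (conjₗ ∘ₗ involuteₗ) (basisVec i)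
    simp
  rw [h, para_eq_sum]
  refine Finset.sum_congr rfl fun i _ => ?_
  refine Fin.cases ?_ (fun i => ?_) i
  · rw [basisVec_zero, reverse_one]
  · rw [basisVec_succ, reverse_e]

/-- Sandwiching a paravector by a paravector gives a paravector. -/
theorem para_mul_para_mul_para (x y : Fin (n + 1) → ℝ) :
    para x * para y * para x =
      para ((2 * ∑ i, x i * conjVec y i) • x - (∑ i, x i ^ 2) • conjVec y) := by
  have h := congrArg (· * para x) (para_mul_conj_add x (conjVec y))
  simp only [add_mul, conj_para, conjVec_conjVec] at h
  rw [mul_assoc (para (conjVec y)), ← conj_para x, conj_mul_para, mul_smul_comm, mul_one,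
    smul_mul_assoc, one_mul] at h
  rw [para_sub, para_smul, para_smul, ← h]
  abel

theorem coord_empty_para_mul_conj (x y : Fin (n + 1) → ℝ) :
    (para x * conj (para y)) ∅ = ∑ i, x i * y i := by
  have h := congrArg (fun a : Cl n => a ∅) (para_mul_conj_add x y)
  have h2 : (para y * conj (para x)) ∅ = (para x * conj (para y)) ∅ := by
    rw [← conj_coord_empty (para y * conj (para x)), conj_mul, conj_conj]
  simp only [add_coord, smul_coord, h2, one_coord_empty] at h
  linarith

/-- A sum against the basis of paravectors recovers a paravector from its inner products. -/
theorem sum_coord_empty_smul_basisVec (w : Fin (n + 1) → ℝ) :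
    ∑ i, (basisVec i * conj (para w)) ∅ • basisVec i = para w := by
  rw [para_eq_sum]
  refine Finset.sum_congr rfl fun i _ => ?_
  rw [← para_eq_sum, ← para_single i, coord_empty_para_mul_conj]
  simp [Pi.single_apply]

/-! ### Products of paravectors -/

/-- The properties of nonzero products of paravectors: they are invertible up to conjugation, and
sandwiching by them preserves paravectors. -/
structure IsVersor (a : Cl n) : Prop where
  ne_zero : a ≠ 0
  mul_conj : a * conj a = normSq a • (1 : Cl n)
  conj_mul : conj a * a = normSq a • (1 : Cl n)
  mul_para_mul_reverse : ∀ v, ∃ w, a * para v * reverse a = para w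
  reverse_mul_para_mul : ∀ v, ∃ w, reverse a * para v * a = para w

theorem normSq_eq_of_mul_conj {a : Cl n} {r : ℝ} (h : a * conj a = r • (1 : Cl n)) :
    normSq a = r := by
  rw [← mul_conj_coord_empty, h, smul_coord, one_coord_empty, mul_one]

theorem IsVersor.normSq_pos {a : Cl n} (ha : IsVersor a) : 0 < normSq a := Cl.normSq_pos ha.ne_zero

theorem normSq_para (x : Fin (n + 1) → ℝ) : normSq (para x) = ∑ i, x i ^ 2 :=
  normSq_eq_of_mul_conj (para_mul_conj x)

theorem isVersor_one : IsVersor (1 : Cl n) := by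
  have h : normSq (1 : Cl n) = 1 := normSq_eq_of_mul_conj (by simp [conj_one])
  refine ⟨fun h0 => ?_, ?_, ?_, fun v => ⟨v, ?_⟩, fun v => ⟨v, ?_⟩⟩
  · have := one_coord_empty (n := n)
    rw [h0] at this
    exact zero_ne_one this
  all_goals simp [h, conj_one, reverse_one]

theorem para_ne_zero {x : Fin (n + 1) → ℝ} (hx : x ≠ 0) : para x ≠ 0 := fun h => hx <| by
  rw [← paraCoord_para x, h, ← para_zero, paraCoord_para]

theorem isVersor_para {x : Fin (n + 1) → ℝ} (hx : x ≠ 0) : IsVersor (para x) where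
  ne_zero := para_ne_zero hx
  mul_conj := by rw [normSq_para, para_mul_conj]
  conj_mul := by rw [normSq_para, conj_mul_para]
  mul_para_mul_reverse v := by rw [reverse_para, para_mul_para_mul_para]; exact ⟨_, rfl⟩
  reverse_mul_para_mul v := by rw [reverse_para, para_mul_para_mul_para]; exact ⟨_, rfl⟩

theorem IsVersor.mul {a b : Cl n} (ha : IsVersor a) (hb : IsVersor b) : IsVersor (a * b) := by
  have h1 : a * b * conj (a * b) = (normSq a * normSq b) • (1 : Cl n) := by
    rw [Cl.conj_mul, mul_assoc, ← mul_assoc b, hb.mul_conj, smul_mul_assoc, one_mul, mul_smul_comm,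
      ha.mul_conj, smul_smul, mul_comm]
  have h2 := normSq_eq_of_mul_conj h1
  refine ⟨fun h => ?_, ?_, ?_, fun v => ?_, fun v => ?_⟩
  · rw [h] at h2
    have h3 : normSq (0 : Cl n) = 0 := by simp [normSq]
    exact (mul_pos ha.normSq_pos hb.normSq_pos).ne (h3.symm.trans h2)
  · rw [h1, h2]
  · rw [h2, Cl.conj_mul, mul_assoc, ← mul_assoc (conj a), ha.conj_mul, smul_mul_assoc, one_mul,
      mul_smul_comm, hb.conj_mul, smul_smul]
  · obtain ⟨w, hw⟩ := hb.mul_para_mul_reverse v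
    obtain ⟨u, hu⟩ := ha.mul_para_mul_reverse w
    exact ⟨u, by rw [← hu, ← hw, reverse_mul]; simp only [mul_assoc]⟩
  · obtain ⟨w, hw⟩ := ha.reverse_mul_para_mul v
    obtain ⟨u, hu⟩ := hb.reverse_mul_para_mul w
    exact ⟨u, by rw [← hu, ← hw, reverse_mul]; simp only [mul_assoc]⟩

theorem IsProdOfParavectors.isVersor {a : Cl n} (ha : IsProdOfParavectors a) : IsVersor a := by
  obtain ⟨l, hl, rfl⟩ := ha
  induction l with
  | nil => exact isVersor_one
  | cons x l ih =>
    exact (isVersor_para (hl x (by simp))).mul (ih fun y hy => hl y (by simp [hy]))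

theorem isVersor_of_eq_zero_or {a : Cl n} (ha : a = 0 ∨ IsProdOfParavectors a) (h : a ≠ 0) :
    IsVersor a :=
  (ha.resolve_left h).isVersor

theorem IsVersor.inv_eq {a : Cl n} (ha : IsVersor a) : inv a = (normSq a)⁻¹ • conj a := by
  have h1 : a * ((normSq a)⁻¹ • conj a) = 1 := by
    rw [mul_smul_comm, ha.mul_conj, smul_smul, inv_mul_cancel₀ ha.normSq_pos.ne', one_smul]
  have h2 : (normSq a)⁻¹ • conj a * a = 1 := by
    rw [smul_mul_assoc, ha.conj_mul, smul_smul, inv_mul_cancel₀ ha.normSq_pos.ne', one_smul]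
  have h : IsInvertible a := ⟨_, h1, h2⟩
  have h3 : a * inv a = 1 := by
    rw [inv, dif_pos h]
    exact h.choose_spec.1
  calc inv a = ((normSq a)⁻¹ • conj a * a) * inv a := by rw [h2, one_mul]
    _ = _ := by rw [mul_assoc, h3, mul_one]

theorem IsVersor.mul_inv {a : Cl n} (ha : IsVersor a) : a * inv a = 1 := by
  rw [ha.inv_eq, mul_smul_comm, ha.mul_conj, smul_smul, inv_mul_cancel₀ ha.normSq_pos.ne', one_smul]

theorem IsVersor.inv_mul {a : Cl n} (ha : IsVersor a) : inv a * a = 1 := by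
  rw [ha.inv_eq, smul_mul_assoc, ha.conj_mul, smul_smul, inv_mul_cancel₀ ha.normSq_pos.ne',
    one_smul]

theorem IsVersor.reverse_mul_involute {a : Cl n} (ha : IsVersor a) :
    reverse a * involute a = normSq a • (1 : Cl n) := by
  rw [reverse_eq, ← involute_conj, ← involute_mul, ha.conj_mul, involute_smul, involute_one]

theorem IsVersor.involute_mul_reverse {a : Cl n} (ha : IsVersor a) :
    involute a * reverse a = normSq a • (1 : Cl n) := by
  rw [reverse_eq, ← involute_conj, ← involute_mul, ha.mul_conj, involute_smul, involute_one]

/-! ### The splitting `Cl_{m+1} = Cl_m ⊕ Cl_m e_top` -/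

section Splitting

variable {m : ℕ}

theorem memSub_add {a b : Cl n} {i : Fin n} (ha : memSub a i) (hb : memSub b i) :
    memSub (a + b) i := fun A hA => by
  have h1 : a A = 0 := ha A hA
  have h2 : b A = 0 := hb A hA
  change a A + b A = 0
  rw [h1, h2, add_zero]

theorem memSub_smul {a : Cl n} {i : Fin n} (r : ℝ) (ha : memSub a i) :
    memSub (r • a) i := fun A hA => by
  have h1 : a A = 0 := ha A hA
  change r * a A = 0
  rw [h1, mul_zero]

theorem memSub_sub {a b : Cl n} {i : Fin n} (ha : memSub a i) (hb : memSub b i) :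
    memSub (a - b) i := by
  rw [sub_eq_add_neg, ← neg_one_smul ℝ b]
  exact memSub_add ha (memSub_smul _ hb)

theorem memSub_conj {a : Cl n} {i : Fin n} (ha : memSub a i) : memSub (conj a) i := fun A hA => by
  have h1 : a A = 0 := ha A hA
  change conj a A = 0
  rw [conj_coord, h1, mul_zero]

theorem memSub_involute {a : Cl n} {i : Fin n} (ha : memSub a i) : memSub (involute a) i :=
  fun A hA => by
    have h1 : a A = 0 := ha A hA
    change (-1 : ℝ) ^ A.card * a A = 0
    rw [h1, mul_zero]

theorem memSub_reverse {a : Cl n} {i : Fin n} (ha : memSub a i) : memSub (reverse a) i := by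
  rw [reverse_eq]; exact memSub_conj (memSub_involute ha)

theorem memSub_mul {a b : Cl n} {i : Fin n} (ha : memSub a i) (hb : memSub b i) :
    memSub (a * b) i := fun C hC => by
  change mul a b C = 0
  rw [mul_coord]
  refine Finset.sum_eq_zero fun A _ => ?_
  by_cases hA : i ∈ A
  · have h1 : a A = 0 := ha A hA
    rw [h1, mul_zero, zero_mul]
  · have h2 : b (A ∆ C) = 0 := hb _ (Finset.mem_symmDiff.2 (Or.inr ⟨hC, hA⟩))
    rw [h2, mul_zero]

theorem memSub_Ppart (a : Cl (m + 1)) : memSub (Ppart a) (Fin.last m) := fun _ hA => if_pos hA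

theorem memSub_Qpart (a : Cl (m + 1)) : memSub (Qpart a) (Fin.last m) := fun _ hA => if_pos hA

theorem e_last_mul {s : Cl (m + 1)} (hs : memSub s (Fin.last m)) :
    e (Fin.last m) * s = involute s * e (Fin.last m) := ext fun C => by
  rw [e_mul_coord, mul_e_coord, symmDiff_comm C]
  change _ = _ * ((-1 : ℝ) ^ ({Fin.last m} ∆ C).card * s ({Fin.last m} ∆ C))
  by_cases h : Fin.last m ∈ ({Fin.last m} : Finset (Fin (m + 1))) ∆ C
  · have h1 : s ({Fin.last m} ∆ C) = 0 := hs _ h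
    rw [h1]; ring
  · generalize ({Fin.last m} : Finset (Fin (m + 1))) ∆ C = B at h
    have h1 : mulSign {Fin.last m} B = (-1) ^ B.card := by
      simp [mulSign_eq_prod, pairSign, Fin.le_last]
    have h2 : mulSign B {Fin.last m} = 1 := by
      rw [mulSign_eq_prod]
      refine Finset.prod_eq_one fun i hi => ?_
      have : ¬ Fin.last m ≤ i := fun h' => h (Fin.last_le_iff.1 h' ▸ hi)
      simp [pairSign, this]
    rw [h1, h2]; ring

theorem mul_e_last_coord_of_mem {t : Cl (m + 1)} {A : Finset (Fin (m + 1))}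
    (hA : Fin.last m ∉ A) : (t * e (Fin.last m)) (insert (Fin.last m) A) = t A := by
  have h1 : insert (Fin.last m) A ∆ {Fin.last m} = A := by
    ext i
    simp only [Finset.mem_symmDiff, Finset.mem_insert, Finset.mem_singleton]
    by_cases hi : i = Fin.last m
    · subst hi; simpa using hA
    · simp [hi]
  have h2 : mulSign A {Fin.last m} = 1 := by
    rw [mulSign_eq_prod]
    refine Finset.prod_eq_one fun i hi => ?_
    have : ¬ Fin.last m ≤ i := fun h' => hA (Fin.last_le_iff.1 h' ▸ hi)
    simp [pairSign, this]
  rw [mul_e_coord, h1, h2, one_mul]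

theorem mul_e_last_coord_of_notMem {t : Cl (m + 1)} (ht : memSub t (Fin.last m))
    {A : Finset (Fin (m + 1))} (hA : Fin.last m ∉ A) : (t * e (Fin.last m)) A = 0 := by
  have h : t (A ∆ {Fin.last m}) = 0 :=
    ht _ (Finset.mem_symmDiff.2 (Or.inr ⟨Finset.mem_singleton_self _, hA⟩))
  rw [mul_e_coord, h, mul_zero]

theorem Qpart_add_mul_e {s t : Cl (m + 1)} (hs : memSub s (Fin.last m))
    (ht : memSub t (Fin.last m)) : Qpart (s + t * e (Fin.last m)) = t := ext fun A => by
  change (if Fin.last m ∈ A then 0 else (s + t * e (Fin.last m)) (insert (Fin.last m) A)) = t A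
  split_ifs with h
  · exact (ht A h).symm
  · have h1 : s (insert (Fin.last m) A) = 0 := hs _ (Finset.mem_insert_self _ _)
    rw [add_coord, h1, mul_e_last_coord_of_mem h, zero_add]

theorem Ppart_add_Qpart_mul_e (a : Cl (m + 1)) :
    a = Ppart a + Qpart a * e (Fin.last m) := ext fun A => by
  rw [add_coord]
  by_cases h : Fin.last m ∈ A
  · have h1 : Ppart a A = 0 := if_pos h
    have h2 := mul_e_last_coord_of_mem (t := Qpart a) (Finset.notMem_erase (Fin.last m) A)
    have h3 : Qpart a (A.erase (Fin.last m)) = a (insert (Fin.last m) (A.erase (Fin.last m))) :=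
      if_neg (Finset.notMem_erase (Fin.last m) A)
    rw [h3, Finset.insert_erase h] at h2
    rw [h1, h2, zero_add]
  · have h1 : Ppart a A = a A := if_neg h
    rw [h1, mul_e_last_coord_of_notMem (memSub_Qpart a) h, add_zero]

theorem para_split (x : Fin (m + 2) → ℝ) :
    ∃ s, memSub s (Fin.last m) ∧ reverse s = s ∧
      para x = s + x (Fin.last (m + 1)) • e (Fin.last m) := by
  refine ⟨para (Function.update x (Fin.last (m + 1)) 0), fun A hA => ?_, reverse_para _, ?_⟩
  · change para _ A = 0
    rw [para, scalar_eq, add_coord, smul_coord, one_coord, sum_coord,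
      if_neg (Finset.ne_empty_of_mem hA), mul_zero, zero_add]
    refine Finset.sum_eq_zero fun i _ => ?_
    rw [smul_coord, e_coord]
    split_ifs with h
    · subst h
      rw [Finset.mem_singleton] at hA
      rw [← hA, Fin.succ_last, Function.update_self, zero_mul]
    · rw [mul_zero]
  · rw [← basisVec_succ, ← para_single, ← para_smul, ← para_add, Fin.succ_last]
    congr 1
    funext i
    by_cases h : i = Fin.last (m + 1)
    · subst h; simp
    · simp [h]

end Splitting

/-! ### Möbius transformations -/

theorem involute_para (x : Fin (n + 1) → ℝ) : involute (para x) = para (conjVec x) := by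
  rw [← conj_reverse, reverse_para, conj_para]

theorem IsVersor.involute_mul_para_mul_conj {a : Cl n} (ha : IsVersor a)
    (v : Fin (n + 1) → ℝ) : ∃ w, involute a * para v * conj a = para w := by
  obtain ⟨w, hw⟩ := ha.mul_para_mul_reverse (conjVec v)
  refine ⟨conjVec w, ?_⟩
  rw [← involute_para, ← hw, involute_mul, involute_mul, involute_para, conjVec_conjVec,
    involute_reverse]

theorem IsVersor.eq_of_mul_reverse_eq_one {a b : Cl n} (hb : IsVersor b)
    (h : a * reverse b = 1) : a = (normSq b)⁻¹ • involute b := by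
  have h1 : a * (reverse b * involute b) = involute b := by rw [← mul_assoc, h, one_mul]
  rw [hb.reverse_mul_involute, mul_smul_comm, mul_one] at h1
  rw [← h1, smul_smul, inv_mul_cancel₀ hb.normSq_pos.ne', one_smul]

theorem memSub_inv {a : Cl n} {i : Fin n} (hv : IsVersor a) (ha : memSub a i) :
    memSub (inv a) i := by
  rw [hv.inv_eq]; exact memSub_smul _ (memSub_conj ha)

theorem reverse_eq_self_of_isParavector {a : Cl n} (ha : IsParavector a) : reverse a = a := by
  obtain ⟨x, rfl⟩ := ha; exact reverse_para x

theorem reverse_smul (r : ℝ) (a : Cl n) : reverse (r • a) = r • reverse a := by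
  simp only [reverse_eq, involute_smul, conj_smul]

theorem reverse_zero : reverse (0 : Cl n) = 0 := by
  simpa using reverse_smul 0 (0 : Cl n)

namespace SAV

variable (M : SAV n)

theorem det_eq : M.a * reverse M.d - M.b * reverse M.c = 1 := M.det

theorem isVersor_c (hc : M.c ≠ 0) : IsVersor M.c := isVersor_of_eq_zero_or M.prod_c hc

theorem a_mul_reverse_d (hc : M.c = 0) : M.a * reverse M.d = 1 := by
  have := M.det_eq
  rwa [hc, reverse_zero, mul_zero, sub_zero] at this

theorem isVersor_d (hc : M.c = 0) : IsVersor M.d := by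
  refine isVersor_of_eq_zero_or M.prod_d fun h => (isVersor_one (n := n)).ne_zero ?_
  rw [← M.a_mul_reverse_d hc, h, reverse_zero, mul_zero]

theorem cxd_eq (x : Fin (n + 1) → ℝ) : cxd M x = M.c * para x + M.d := rfl

theorem axb_eq (x : Fin (n + 1) → ℝ) : axb M x = M.a * para x + M.b := rfl

theorem isParavector_a_mul_inv_c (hc : M.c ≠ 0) : IsParavector (M.a * inv M.c) :=
  (M.cond_c hc).1

theorem isParavector_inv_c_mul_d (hc : M.c ≠ 0) : IsParavector (inv M.c * M.d) :=
  (M.cond_c hc).2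

theorem c_mul_inv_mul_d (hc : M.c ≠ 0) : M.c * (inv M.c * M.d) = M.d := by
  rw [← mul_assoc, (M.isVersor_c hc).mul_inv, one_mul]

theorem a_mul_inv_mul_c (hc : M.c ≠ 0) : M.a * inv M.c * M.c = M.a := by
  rw [mul_assoc, (M.isVersor_c hc).inv_mul, mul_one]

theorem a_mul_inv_c_mul_d_sub_b (hc : M.c ≠ 0) :
    M.a * (inv M.c * M.d) - M.b = (normSq M.c)⁻¹ • involute M.c := by
  refine (M.isVersor_c hc).eq_of_mul_reverse_eq_one ?_
  have h : inv M.c * M.d * reverse M.c = reverse M.d := by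
    have h1 := congrArg reverse (M.c_mul_inv_mul_d hc)
    rwa [reverse_mul, reverse_eq_self_of_isParavector (M.isParavector_inv_c_mul_d hc)] at h1
  rw [sub_mul, mul_assoc, h, M.det_eq]

theorem reverse_c_mul_a : reverse M.c * M.a = reverse M.a * M.c := by
  by_cases hc : M.c = 0
  · rw [hc, reverse_zero, zero_mul, mul_zero]
  · have h := congrArg reverse (M.a_mul_inv_mul_c hc)
    rw [reverse_mul, reverse_eq_self_of_isParavector (M.isParavector_a_mul_inv_c hc)] at h
    rw [← h, mul_assoc (reverse M.c), M.a_mul_inv_mul_c hc]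

theorem reverse_d_mul_a_sub : reverse M.d * M.a - reverse M.b * M.c = 1 := by
  by_cases hc : M.c = 0
  · have hd := M.isVersor_d hc
    rw [hc, mul_zero, sub_zero, hd.eq_of_mul_reverse_eq_one (M.a_mul_reverse_d hc), mul_smul_comm,
      hd.reverse_mul_involute, smul_smul, inv_mul_cancel₀ hd.normSq_pos.ne', one_smul]
  · have hv := M.isVersor_c hc
    have h1 := congrArg reverse (M.a_mul_inv_c_mul_d_sub_b hc)
    have h2 := congrArg reverse (M.c_mul_inv_mul_d hc)
    rw [reverse_mul, reverse_eq_self_of_isParavector (M.isParavector_inv_c_mul_d hc)] at h2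
    rw [reverse_sub, reverse_mul, reverse_eq_self_of_isParavector (M.isParavector_inv_c_mul_d hc), reverse_smul,
      reverse_involute, ← hv.inv_eq, sub_eq_iff_eq_add] at h1
    rw [← h2, mul_assoc, M.reverse_c_mul_a, ← mul_assoc, h1, add_mul, hv.inv_mul, add_sub_cancel_right]

end SAV

namespace SAVsub

variable {m : ℕ} (M : SAVsub m) {x : Fin (m + 2) → ℝ}

/-- For `c ≠ 0` the denominator is `c` times a nonzero paravector. -/
theorem exists_cxd_eq (hc : M.c ≠ 0) (hx : x ∈ upperHalf (m + 1)) :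
    ∃ y, y ≠ 0 ∧ cxd M.toSAV x = M.c * para y := by
  obtain ⟨u, hu⟩ := M.isParavector_inv_c_mul_d hc
  refine ⟨x + u, fun h => ?_, ?_⟩
  · have h1 : u (Fin.last m).succ = 0 := by
      rw [← para_coord_singleton u (Fin.last m), ← hu]
      exact memSub_mul (memSub_inv (M.isVersor_c hc) M.sub_c) M.sub_d _
        (Finset.mem_singleton_self _)
    have h2 := congrFun h (Fin.last (m + 1))
    rw [Pi.add_apply, ← Fin.succ_last, h1, add_zero] at h2
    have hx' : 0 < x (Fin.last (m + 1)) := hx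
    exact hx'.ne' h2
  · rw [para_add, mul_add, ← hu, M.c_mul_inv_mul_d hc, M.cxd_eq]

theorem isVersor_cxd (hx : x ∈ upperHalf (m + 1)) : IsVersor (cxd M.toSAV x) := by
  by_cases hc : M.c = 0
  · rw [M.cxd_eq, hc, zero_mul, zero_add]
    exact M.isVersor_d hc
  · obtain ⟨y, hy, h⟩ := M.exists_cxd_eq hc hx
    rw [h]
    exact (M.isVersor_c hc).mul (isVersor_para hy)

theorem exists_conj_c_mul_cxd (hx : x ∈ upperHalf (m + 1)) :
    ∃ w, conj M.c * cxd M.toSAV x = para w := by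
  by_cases hc : M.c = 0
  · refine ⟨0, ?_⟩
    rw [para_zero, hc, ← zero_smul ℝ (0 : Cl (m + 1)), conj_smul, zero_smul, zero_smul, zero_mul]
  · obtain ⟨y, -, h⟩ := M.exists_cxd_eq hc hx
    refine ⟨normSq M.c • y, ?_⟩
    rw [h, ← mul_assoc, (M.isVersor_c hc).conj_mul, smul_mul_assoc, one_mul, para_smul]

theorem moebiusCl_mul_cxd (hx : x ∈ upperHalf (m + 1)) :
    moebiusCl M.toSAV x * cxd M.toSAV x = axb M.toSAV x := by
  rw [moebiusCl, mul_eq, mul_assoc, (M.isVersor_cxd hx).inv_mul, mul_one]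

theorem isParavector_moebiusCl (hx : x ∈ upperHalf (m + 1)) :
    IsParavector (moebiusCl M.toSAV x) := by
  have hq := M.isVersor_cxd hx
  by_cases hc : M.c = 0
  · have hd := M.isVersor_d hc
    obtain ⟨u, hu⟩ := M.cond_c0 hc
    obtain ⟨w, hw⟩ := hd.involute_mul_para_mul_conj x
    have hq' : cxd M.toSAV x = M.d := by rw [M.cxd_eq, hc, zero_mul, zero_add]
    refine ⟨((normSq M.d)⁻¹ * (normSq M.d)⁻¹) • w + u, ?_⟩
    rw [moebiusCl, hq', M.axb_eq, mul_eq, add_mul, para_add, ← hu, para_smul, ← hw, hd.inv_eq,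
      hd.eq_of_mul_reverse_eq_one (M.a_mul_reverse_d hc), mul_eq]
    simp only [smul_mul_assoc, mul_smul_comm, smul_smul]
  · have hv := M.isVersor_c hc
    obtain ⟨y, -, h⟩ := M.exists_cxd_eq hc hx
    obtain ⟨u, hu⟩ := M.isParavector_a_mul_inv_c hc
    obtain ⟨w, hw⟩ := hv.involute_mul_para_mul_conj (conjVec y)
    have h1 : axb M.toSAV x = M.a * inv M.c * cxd M.toSAV x -
        (M.a * (inv M.c * M.d) - M.b) := by
      rw [M.cxd_eq, mul_add, ← mul_assoc (M.a * inv M.c), M.a_mul_inv_mul_c hc, M.axb_eq,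
        mul_assoc M.a (inv M.c)]
      abel
    refine ⟨u - ((normSq M.c)⁻¹ * (normSq (cxd M.toSAV x))⁻¹) • w, ?_⟩
    rw [moebiusCl, mul_eq, h1, sub_mul, mul_assoc, hq.mul_inv, mul_one, para_sub, ← hu,
      M.a_mul_inv_c_mul_d_sub_b hc, para_smul, ← hw, ← conj_para, hq.inv_eq, h, Cl.conj_mul]
    simp only [smul_mul_assoc, mul_smul_comm, smul_smul, mul_assoc, mul_comm]

theorem para_moebius (hx : x ∈ upperHalf (m + 1)) :
    para (moebius M.toSAV x) = moebiusCl M.toSAV x := by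
  obtain ⟨y, hy⟩ := M.isParavector_moebiusCl hx
  rw [moebius, hy, paraCoord_para]

theorem reverse_cxd_mul (hx : x ∈ upperHalf (m + 1)) :
    reverse (cxd M.toSAV x) * (M.a - moebiusCl M.toSAV x * M.c) = 1 := by
  have h1 := congrArg reverse (M.moebiusCl_mul_cxd hx)
  rw [reverse_mul, reverse_eq_self_of_isParavector (M.isParavector_moebiusCl hx)] at h1
  rw [mul_sub, ← mul_assoc, h1, M.axb_eq, M.cxd_eq, reverse_add, reverse_add, reverse_mul,
    reverse_mul, reverse_para, add_mul, add_mul, mul_assoc, M.reverse_c_mul_a, ← mul_assoc,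
    add_sub_add_left_eq_sub, M.reverse_d_mul_a_sub]

theorem e_last_mul_conj {p : Cl (m + 1)} (hp : memSub p (Fin.last m)) :
    e (Fin.last m) * conj p = reverse p * e (Fin.last m) := by
  rw [e_last_mul (memSub_conj hp), involute_conj, ← reverse_eq]

theorem e_last_mul_reverse {p : Cl (m + 1)} (hp : memSub p (Fin.last m)) :
    e (Fin.last m) * reverse p = conj p * e (Fin.last m) := by
  rw [e_last_mul (memSub_reverse hp), involute_reverse]

variable (x) in
theorem exists_conj_cxd_eq : ∃ s, memSub s (Fin.last m) ∧ reverse s = s ∧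
    para x = s + x (Fin.last (m + 1)) • e (Fin.last m) ∧
    conj (cxd M.toSAV x) = conj (M.c * s + M.d) -
      x (Fin.last (m + 1)) • (reverse M.c * e (Fin.last m)) := by
  obtain ⟨s, hs, hr, h⟩ := para_split x
  refine ⟨s, hs, hr, h, ?_⟩
  rw [M.cxd_eq, h, mul_add, mul_smul_comm, add_right_comm, conj_add, conj_smul, Cl.conj_mul,
    conj_e, neg_mul, e_last_mul_conj M.sub_c, smul_neg, sub_eq_add_neg]

theorem axb_mul_conj_cxd_coord (x : Fin (m + 2) → ℝ) :
    (axb M.toSAV x * conj (cxd M.toSAV x)) {Fin.last m} = x (Fin.last (m + 1)) := by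
  obtain ⟨s, hs, hr, h, hq⟩ := M.exists_conj_cxd_eq x
  set t := x (Fin.last (m + 1))
  have hp : memSub (M.c * s + M.d) (Fin.last m) := memSub_add (memSub_mul M.sub_c hs) M.sub_d
  have hdet : M.a * reverse (M.c * s + M.d) - (M.a * s + M.b) * reverse M.c = 1 := by
    rw [reverse_add, reverse_mul, hr, mul_add, add_mul, ← M.det_eq, mul_assoc]
    abel
  have key : axb M.toSAV x * conj (cxd M.toSAV x) =
      ((M.a * s + M.b) * conj (M.c * s + M.d) + (t * t) • (M.a * conj M.c)) +
        t • e (Fin.last m) := by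
    have h1 : M.a * e (Fin.last m) * conj (M.c * s + M.d) =
        M.a * reverse (M.c * s + M.d) * e (Fin.last m) := by
      rw [mul_assoc, e_last_mul_conj hp, ← mul_assoc]
    have h2 : M.a * e (Fin.last m) * (reverse M.c * e (Fin.last m)) = -(M.a * conj M.c) := by
      rw [mul_assoc, ← mul_assoc (e _), e_last_mul_reverse M.sub_c, mul_assoc, e_mul_e_self]
      simp
    rw [hq, M.axb_eq, h, mul_add, add_right_comm, add_mul, mul_sub, mul_smul_comm t M.a,
      smul_mul_assoc, mul_sub, h1, mul_smul_comm, mul_smul_comm, h2, smul_sub, smul_smul]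
    nth_rewrite 3 [← one_mul (e (Fin.last m))]
    rw [← hdet, sub_mul, smul_sub, smul_neg]
    simp only [mul_assoc]
    abel
  have hsub : memSub ((M.a * s + M.b) * conj (M.c * s + M.d) + (t * t) • (M.a * conj M.c))
      (Fin.last m) :=
    memSub_add (memSub_mul (memSub_add (memSub_mul M.sub_a hs) M.sub_b) (memSub_conj hp))
      (memSub_smul _ (memSub_mul M.sub_a (memSub_conj M.sub_c)))
  have h0 := hsub {Fin.last m} (Finset.mem_singleton_self _)
  rw [coeff] at h0
  rw [key, add_coord, h0, smul_coord, e_coord, if_pos rfl, zero_add, mul_one]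

theorem moebius_last (hx : x ∈ upperHalf (m + 1)) :
    moebius M.toSAV x (Fin.last (m + 1)) =
      x (Fin.last (m + 1)) / normSq (cxd M.toSAV x) := by
  rw [← Fin.succ_last]
  change moebiusCl M.toSAV x {Fin.last m} = _
  rw [moebiusCl, (M.isVersor_cxd hx).inv_eq, mul_eq, mul_smul_comm, smul_coord,
    M.axb_mul_conj_cxd_coord, Fin.succ_last, div_eq_inv_mul]

theorem moebius_mem_upperHalf (hx : x ∈ upperHalf (m + 1)) :
    moebius M.toSAV x ∈ upperHalf (m + 1) := by
  change 0 < moebius M.toSAV x (Fin.last (m + 1))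
  rw [M.moebius_last hx]
  exact div_pos hx (M.isVersor_cxd hx).normSq_pos

theorem involute_Qpart_conj_cxd_mul (x : Fin (m + 2) → ℝ) (f : Cl (m + 1)) :
    involute (Qpart (conj (cxd M.toSAV x) * f)) =
      reverse (cxd M.toSAV x) * involute (Qpart f) -
        x (Fin.last (m + 1)) • (conj M.c * f) := by
  obtain ⟨s, hs, hr, h, hq⟩ := M.exists_conj_cxd_eq x
  set t := x (Fin.last (m + 1))
  have hp : memSub (M.c * s + M.d) (Fin.last m) := memSub_add (memSub_mul M.sub_c hs) M.sub_d
  have hrev : reverse (cxd M.toSAV x) = reverse (M.c * s + M.d) +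
      t • (conj M.c * e (Fin.last m)) := by
    rw [M.cxd_eq, h, mul_add, mul_smul_comm, add_right_comm, reverse_add, reverse_smul,
      reverse_mul (M.c) (e _), reverse_e, e_last_mul_reverse M.sub_c]
  have hP := memSub_Ppart f
  have hQ := memSub_Qpart f
  have hf := Ppart_add_Qpart_mul_e f
  generalize Ppart f = P at *
  generalize Qpart f = Q at *
  have hsplit : conj (cxd M.toSAV x) * f =
      (conj (M.c * s + M.d) * P + t • (reverse M.c * involute Q)) +
        (conj (M.c * s + M.d) * Q - t • (reverse M.c * involute P)) * e (Fin.last m) := by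
    have h1 : reverse M.c * e (Fin.last m) * P = reverse M.c * involute P * e (Fin.last m) := by
      rw [mul_assoc, e_last_mul hP, ← mul_assoc]
    have h2 : reverse M.c * e (Fin.last m) * (Q * e (Fin.last m)) =
        -(reverse M.c * involute Q) := by
      rw [mul_assoc, ← mul_assoc (e _), e_last_mul hQ, mul_assoc, e_mul_e_self]
      simp
    rw [hq, hf, mul_add, sub_mul, sub_mul, smul_mul_assoc, smul_mul_assoc, h1, h2, sub_mul,
      smul_mul_assoc, smul_neg, mul_assoc (conj _) Q]
    abel
  rw [hsplit, Qpart_add_mul_e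
    (memSub_add (memSub_mul (memSub_conj hp) hP)
      (memSub_smul _ (memSub_mul (memSub_reverse M.sub_c) (memSub_involute hQ))))
    (memSub_sub (memSub_mul (memSub_conj hp) hQ)
      (memSub_smul _ (memSub_mul (memSub_reverse M.sub_c) (memSub_involute hP)))),
    involute_sub, involute_mul, involute_smul, involute_mul, involute_involute, involute_reverse,
    involute_conj, ← reverse_eq, hrev, hf, add_mul, smul_mul_assoc, mul_assoc (conj M.c),
    e_last_mul (memSub_involute hQ), involute_involute, mul_add, smul_add]
  abel

end SAVsub

/-! ### Derivatives -/

section Calculus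

variable {E : Type*} [NormedAddCommGroup E] [NormedSpace ℝ E]

theorem hasFDerivAt_mul {f g : E → Cl n} {f' g' : E →L[ℝ] Cl n} {x : E}
    (hf : HasFDerivAt f f' x) (hg : HasFDerivAt g g' x) :
    ∃ L : E →L[ℝ] Cl n, HasFDerivAt (fun y => f y * g y) L x ∧
      ∀ v, L v = f x * g' v + f' v * g x := by
  let B : Cl n →L[ℝ] Cl n →L[ℝ] Cl n := LinearMap.toContinuousBilinearMap (LinearMap.mul ℝ (Cl n))
  exact ⟨_, B.hasFDerivAt_of_bilinear hf hg, fun v => rfl⟩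

theorem hasFDerivAt_conj {f : E → Cl n} {f' : E →L[ℝ] Cl n} {x : E} (hf : HasFDerivAt f f' x) :
    ∃ L : E →L[ℝ] Cl n, HasFDerivAt (fun y => conj (f y)) L x ∧ ∀ v, L v = conj (f' v) :=
  ⟨_, (LinearMap.toContinuousLinearMap (conjₗ (n := n))).hasFDerivAt.comp x hf, fun _ => rfl⟩

theorem hasFDerivAt_para (x : Fin (n + 1) → ℝ) :
    HasFDerivAt para (LinearMap.toContinuousLinearMap (paraₗ (n := n))) x :=
  (LinearMap.toContinuousLinearMap (paraₗ (n := n))).hasFDerivAt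

theorem hasFDerivAt_mul_para_add (a b : Cl n) (x : Fin (n + 1) → ℝ) :
    ∃ L : (Fin (n + 1) → ℝ) →L[ℝ] Cl n, HasFDerivAt (fun y => a * para y + b) L x ∧
      ∀ v, L v = a * para v :=
  ⟨LinearMap.toContinuousLinearMap (LinearMap.mulLeft ℝ a ∘ₗ paraₗ),
    (LinearMap.toContinuousLinearMap (LinearMap.mulLeft ℝ a ∘ₗ paraₗ)).hasFDerivAt.add_const b,
    fun _ => rfl⟩

theorem hasFDerivAt_normSq {f : E → Cl n} {f' : E →L[ℝ] Cl n} {x : E} (hf : HasFDerivAt f f' x) :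
    ∃ L : E →L[ℝ] ℝ, HasFDerivAt (fun y => normSq (f y)) L x ∧
      ∀ v, L v = 2 * (f' v * conj (f x)) ∅ := by
  obtain ⟨L₁, h₁, h₁v⟩ := hasFDerivAt_conj hf
  obtain ⟨L₂, h₂, h₂v⟩ := hasFDerivAt_mul hf h₁
  let ev : Cl n →ₗ[ℝ] ℝ :=
    { toFun := fun a => a ∅
      map_add' := fun _ _ => rfl
      map_smul' := fun _ _ => rfl }
  refine ⟨_, ((LinearMap.toContinuousLinearMap ev).hasFDerivAt.comp x h₂).congr_of_eventuallyEq
    (Filter.Eventually.of_forall fun y => (mul_conj_coord_empty (f y)).symm), fun v => ?_⟩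
  change L₂ v ∅ = _
  rw [h₂v, h₁v, add_coord, ← conj_coord_empty (f x * _), conj_mul, conj_conj, two_mul]

theorem dirac_eq_sum (f : (Fin (n + 1) → ℝ) → Cl n) (x : Fin (n + 1) → ℝ) :
    dirac f x = ∑ i, basisVec i * fderiv ℝ f x (Pi.single i 1) := by
  rw [Fin.sum_univ_succ, basisVec_zero, one_mul]
  rfl

theorem isOpen_upperHalf (n : ℕ) : IsOpen (upperHalf n) :=
  isOpen_lt continuous_const (continuous_apply _)

theorem inv_norm_rpow (a : Cl n) (s : ℝ) : (norm a ^ s)⁻¹ = normSq a ^ (-(s / 2)) := by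
  rw [Real.rpow_neg (normSq_nonneg a), norm, ← normSq, Real.sqrt_eq_rpow,
    ← Real.rpow_mul (normSq_nonneg a)]
  congr 2
  ring

/-- Change of variables in the Dirac operator under the conformal linear map `T` with
`reverse q * T v * q = v`. -/
theorem sum_basisVec_mul_conj_mul {q : Cl n} (hq : IsVersor q)
    {T : (Fin (n + 1) → ℝ) → Fin (n + 1) → ℝ}
    (hT : ∀ v, reverse q * para (T v) * q = para v) (L : (Fin (n + 1) → ℝ) →ₗ[ℝ] Cl n) :
    ∑ i, basisVec i * (conj q * L (T (Pi.single i 1))) =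
      (normSq q)⁻¹ • (reverse q * ∑ j, basisVec j * L (Pi.single j 1)) := by
  have hN := hq.normSq_pos.ne'
  have hTv (v) : para (T v) =
      ((normSq q)⁻¹ * (normSq q)⁻¹) • (involute q * para v * conj q) := by
    rw [← hT v]
    have : involute q * (reverse q * para (T v) * q) * conj q =
        (involute q * reverse q) * para (T v) * (q * conj q) := by simp only [mul_assoc]
    rw [this, hq.involute_mul_reverse, hq.mul_conj, smul_mul_assoc, one_mul, mul_smul_comm, mul_one,
      smul_smul, smul_smul, show (normSq q)⁻¹ * (normSq q)⁻¹ * normSq q * normSq q = 1 by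
        field_simp, one_smul]
  have hcoord (i j) : T (Pi.single i 1) j = ((normSq q)⁻¹ * (normSq q)⁻¹) *
      (basisVec i * conj (reverse q * basisVec j * q)) ∅ := by
    have h1 : T (Pi.single i 1) j = (para (T (Pi.single i 1)) * conj (basisVec j)) ∅ := by
      rw [← para_single j, coord_empty_para_mul_conj]
      simp [Pi.single_apply]
    rw [h1, hTv, para_single, smul_mul_assoc, smul_coord]
    congr 1
    rw [conj_mul, conj_mul, conj_reverse, mul_assoc, mul_assoc, mul_coord_empty_comm]
    simp only [mul_assoc]
  have hsum (j) : ∑ i, T (Pi.single i 1) j • basisVec i =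
      ((normSq q)⁻¹ * (normSq q)⁻¹) • (reverse q * basisVec j * q) := by
    obtain ⟨w, hw⟩ := hq.reverse_mul_para_mul (Pi.single j 1)
    rw [para_single] at hw
    simp only [hcoord, hw, mul_smul, ← Finset.smul_sum, sum_coord_empty_smul_basisVec]
  have hL (v) : L v = ∑ j, v j • L (Pi.single j 1) := by
    conv_lhs => rw [pi_eq_sum_univ' v]
    simp [map_sum, map_smul]
  calc ∑ i, basisVec i * (conj q * L (T (Pi.single i 1)))
      = ∑ i, ∑ j, (T (Pi.single i 1) j • basisVec i) * (conj q * L (Pi.single j 1)) := by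
        refine Finset.sum_congr rfl fun i _ => ?_
        rw [hL, Finset.mul_sum, Finset.mul_sum]
        simp only [mul_smul_comm, smul_mul_assoc]
    _ = ∑ j, (normSq q)⁻¹ • (reverse q * (basisVec j * L (Pi.single j 1))) := by
        rw [Finset.sum_comm]
        refine Finset.sum_congr rfl fun j _ => ?_
        rw [← Finset.sum_mul, hsum, smul_mul_assoc, mul_assoc _ q, ← mul_assoc q, hq.mul_conj,
          smul_mul_assoc, one_mul, mul_smul_comm, smul_smul, mul_assoc, mul_assoc,
          inv_mul_cancel₀ hN, mul_one]
    _ = _ := by rw [← Finset.smul_sum, ← Finset.mul_sum]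

end Calculus

namespace SAVsub

variable {m : ℕ} (M : SAVsub m) {x : Fin (m + 2) → ℝ}

theorem exists_hasFDerivAt_moebius (hx : x ∈ upperHalf (m + 1)) :
    ∃ T : (Fin (m + 2) → ℝ) →L[ℝ] Fin (m + 2) → ℝ, HasFDerivAt (moebius M.toSAV) T x ∧
      ∀ v, reverse (cxd M.toSAV x) * para (T v) * cxd M.toSAV x = para v := by
  have hnhds := (isOpen_upperHalf (m + 1)).mem_nhds hx
  obtain ⟨Lq, hq, hqv⟩ := hasFDerivAt_mul_para_add M.c M.d x
  obtain ⟨La, ha, hav⟩ := hasFDerivAt_mul_para_add M.a M.b x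
  obtain ⟨Lc, hc, -⟩ := hasFDerivAt_conj hq
  obtain ⟨LN, hN, -⟩ := hasFDerivAt_normSq hq
  have hN0 : normSq (M.c * para x + M.d) ≠ 0 := (M.isVersor_cxd hx).normSq_pos.ne'
  obtain ⟨LH, hH, -⟩ := hasFDerivAt_mul ha
    (((hasDerivAt_inv hN0).comp_hasFDerivAt x hN).fun_smul hc)
  let co : Cl (m + 1) →ₗ[ℝ] Fin (m + 2) → ℝ :=
    { toFun := paraCoord
      map_add' := fun _ _ => by funext i; refine Fin.cases rfl (fun _ => rfl) i
      map_smul' := fun _ _ => by funext i; refine Fin.cases rfl (fun _ => rfl) i }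
  have hmoeb := ((LinearMap.toContinuousLinearMap co).hasFDerivAt.comp x hH).congr_of_eventuallyEq
    (f₁ := moebius M.toSAV) (by
      filter_upwards [hnhds] with y hy
      change paraCoord (axb M.toSAV y * inv (cxd M.toSAV y)) = _
      rw [(M.isVersor_cxd hy).inv_eq]
      rfl)
  obtain ⟨L, hL, hLv⟩ := hasFDerivAt_mul ((hasFDerivAt_para _).comp x hmoeb) hq
  have hLa : L = La := hL.unique (ha.congr_of_eventuallyEq (by
    filter_upwards [hnhds] with y hy
    exact (congrArg (· * _) (M.para_moebius hy)).trans (M.moebiusCl_mul_cxd hy)))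
  refine ⟨_, hmoeb, fun v => ?_⟩
  have h := hLv v
  rw [hLa, hav, hqv] at h
  have h' : M.a * para v = moebiusCl M.toSAV x * (M.c * para v) +
      para (((LinearMap.toContinuousLinearMap co).comp LH) v) * cxd M.toSAV x := by
    rw [← M.para_moebius hx]; exact h
  rw [mul_assoc, ← sub_eq_iff_eq_add'.2 h', ← mul_assoc (moebiusCl _ x), ← sub_mul, ← mul_assoc,
    M.reverse_cxd_mul hx, one_mul]

theorem sum_basisVec_mul_conj_basisVec :
    ∑ i, basisVec i * conj (basisVec i : Cl n) = ((n : ℝ) + 1) • (1 : Cl n) := by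
  have h (i : Fin (n + 1)) : basisVec i * conj (basisVec i : Cl n) = 1 := by
    rw [← para_single, para_mul_conj]
    simp [Pi.single_apply]
  simp only [h]
  rw [Finset.sum_const, Finset.card_univ, Fintype.card_fin, ← Nat.cast_smul_eq_nsmul ℝ]
  push_cast
  rfl

/-- The Dirac operator applied to the transformed function, expressed through the Dirac operator
of the original one. -/
theorem dirac_smul_conj_cxd_mul_comp_moebius (hx : x ∈ upperHalf (m + 1)) (s : ℝ)
    {f : (Fin (m + 2) → ℝ) → Cl (m + 1)} (hf : DifferentiableAt ℝ f (moebius M.toSAV x)) :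
    dirac (fun y => normSq (cxd M.toSAV y) ^ (-(s / 2)) •
        (conj (cxd M.toSAV y) * f (moebius M.toSAV y))) x =
      normSq (cxd M.toSAV x) ^ (-(s / 2)) •
        (((m : ℝ) + 2 - s) • (conj M.c * f (moebius M.toSAV x)) +
          (normSq (cxd M.toSAV x))⁻¹ •
            (reverse (cxd M.toSAV x) * dirac f (moebius M.toSAV x))) := by
  have hv := M.isVersor_cxd hx
  obtain ⟨T, hT, hTv⟩ := M.exists_hasFDerivAt_moebius hx
  obtain ⟨w, hw⟩ := M.exists_conj_c_mul_cxd hx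
  obtain ⟨Lq, hq, hqv⟩ := hasFDerivAt_mul_para_add M.c M.d x
  change HasFDerivAt (cxd M.toSAV) Lq x at hq
  obtain ⟨Lc, hc, hcv⟩ := hasFDerivAt_conj hq
  obtain ⟨LN, hN, hNv⟩ := hasFDerivAt_normSq hq
  have hcomp : HasFDerivAt (fun y => f (moebius M.toSAV y))
      ((fderiv ℝ f (moebius M.toSAV x)).comp T) x := hf.hasFDerivAt.comp x hT
  obtain ⟨L, hL, hLv⟩ := hasFDerivAt_mul hc hcomp
  have hF := (hN.rpow_const (p := -(s / 2)) (Or.inl hv.normSq_pos.ne')).fun_smul hL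
  have hN0 := hv.normSq_pos.ne'
  have hsum : ∑ i, basisVec i * (conj (cxd M.toSAV x) *
        fderiv ℝ f (moebius M.toSAV x) (T (Pi.single i 1))) =
      (normSq (cxd M.toSAV x))⁻¹ • (reverse (cxd M.toSAV x) *
        ∑ j, basisVec j * fderiv ℝ f (moebius M.toSAV x) (Pi.single j 1)) :=
    sum_basisVec_mul_conj_mul hv hTv (fderiv ℝ f (moebius M.toSAV x)).toLinearMap
  have hLNv (i) : LN (Pi.single i 1) = 2 * (basisVec i * conj (para w)) ∅ := by
    rw [hNv, hqv, para_single, ← hw, conj_mul, conj_conj, mul_assoc, mul_coord_empty_comm,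
      mul_assoc]
  rw [dirac_eq_sum, hF.fderiv, dirac_eq_sum]
  have hterm (i) : basisVec i * (normSq (cxd M.toSAV x) ^ (-(s / 2)) • L +
      ((-(s / 2) * normSq (cxd M.toSAV x) ^ (-(s / 2) - 1)) • LN).smulRight
        (conj (cxd M.toSAV x) * f (moebius M.toSAV x))) (Pi.single i 1) =
      normSq (cxd M.toSAV x) ^ (-(s / 2)) •
        (basisVec i * (conj (cxd M.toSAV x) *
            fderiv ℝ f (moebius M.toSAV x) (T (Pi.single i 1))) +
          basisVec i * conj (basisVec i) * (conj M.c * f (moebius M.toSAV x)) -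
          (s * (normSq (cxd M.toSAV x))⁻¹) • ((basisVec i * conj (para w)) ∅ • basisVec i *
            (conj (cxd M.toSAV x) * f (moebius M.toSAV x)))) := by
    change basisVec i * (normSq (cxd M.toSAV x) ^ (-(s / 2)) • L (Pi.single i 1) +
      ((-(s / 2) * normSq (cxd M.toSAV x) ^ (-(s / 2) - 1)) * LN (Pi.single i 1)) •
        (conj (cxd M.toSAV x) * f (moebius M.toSAV x))) = _
    rw [hLNv, hLv, hcv, hqv, para_single, conj_mul, Real.rpow_sub_one hN0]
    change basisVec i * (normSq (cxd M.toSAV x) ^ (-(s / 2)) •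
      (conj (cxd M.toSAV x) * fderiv ℝ f (moebius M.toSAV x) (T (Pi.single i 1)) +
        conj (basisVec i) * conj M.c * f (moebius M.toSAV x)) + _) = _
    rw [mul_add, mul_smul_comm, mul_smul_comm, smul_mul_assoc, smul_sub, smul_smul, smul_smul,
      mul_add, mul_assoc (conj (basisVec i)), mul_assoc (basisVec i) (conj (basisVec i)),
      sub_eq_add_neg, ← neg_smul]
    congr 2
    ring
  rw [Finset.sum_congr rfl fun i _ => hterm i, ← Finset.smul_sum]
  congr 1
  rw [Finset.sum_sub_distrib, Finset.sum_add_distrib, ← Finset.smul_sum, ← Finset.sum_mul,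
    ← Finset.sum_mul, sum_basisVec_mul_conj_basisVec, sum_coord_empty_smul_basisVec, ← hw,
    mul_assoc (conj M.c), ← mul_assoc (cxd M.toSAV x), hv.mul_conj, smul_mul_assoc, one_mul,
    smul_mul_assoc, one_mul, mul_smul_comm, smul_smul, mul_assoc s, inv_mul_cancel₀ hN0, mul_one, hsum, sub_smul,
    Nat.cast_add, Nat.cast_one, show (m : ℝ) + 1 + 1 = m + 2 by ring]
  abel

/-- The equation `Df + k (Qf)′/xₙ = 0` at `M<x>` implies the same equation at `x` for the
transformed function. -/
theorem dirac_add_involute_Qpart_eq_zero (hx : x ∈ upperHalf (m + 1)) (k : ℝ)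
    {f : (Fin (m + 2) → ℝ) → Cl (m + 1)} (hf : DifferentiableAt ℝ f (moebius M.toSAV x))
    (hmono : dirac f (moebius M.toSAV x) + (k / moebius M.toSAV x (Fin.last (m + 1))) •
      involute (Qpart (f (moebius M.toSAV x))) = 0) :
    let F := fun y => normSq (cxd M.toSAV y) ^ (-(((m : ℝ) + 2 - k) / 2)) •
      (conj (cxd M.toSAV y) * f (moebius M.toSAV y))
    dirac F x + (k / x (Fin.last (m + 1))) • involute (Qpart (F x)) = 0 := by
  have hx0 : x (Fin.last (m + 1)) ≠ 0 := ne_of_gt hx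
  have hN0 := (M.isVersor_cxd hx).normSq_pos.ne'
  have hQ (r : ℝ) (a : Cl (m + 1)) : Qpart (r • a) = r • Qpart a := Cl.ext fun A => by
    simp [Qpart]
  intro F
  rw [M.dirac_smul_conj_cxd_mul_comp_moebius hx _ hf, eq_neg_of_add_eq_zero_left hmono,
    M.moebius_last hx, hQ, involute_smul, M.involute_Qpart_conj_cxd_mul]
  simp only [mul_neg, mul_smul_comm]
  match_scalars <;> field_simp <;> ring

end SAVsub

end Cl


/-- Quasi-invariance of `k`-hypermonogenic functions under Möbius transformations induced
by `M ∈ SAV(ℝ ⊕ ℝ^{n-1})` (`n = m + 2 ≥ 2`): if `Df + k (Qf)′/xₙ = 0` on `H⁺`, then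
`F = (conj(cx+d)/‖cx+d‖^{n+1-k}) f(M<x>)` also satisfies `DF + k (QF)′/xₙ = 0` on `H⁺`. -/
theorem k_hypermonogenic_moebius_invariance
    (m : ℕ) (k : ℝ) (M : Cl.SAVsub (m + 1))
    (f : (Fin (m + 3) → ℝ) → Cl (m + 2))
    (hf : ContDiffOn ℝ (⊤ : ℕ∞) f (Cl.upperHalf (m + 2)))
    (hmono : ∀ x ∈ Cl.upperHalf (m + 2),
      Cl.dirac f x + (k / x (Fin.last (m + 2))) • Cl.involute (Cl.Qpart (f x)) = 0)
    (F : (Fin (m + 3) → ℝ) → Cl (m + 2))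
    (hF : F = fun x => (Cl.norm (Cl.cxd M.toSAV x) ^ ((((m : ℝ) + 2) + 1) - k))⁻¹ •
      Cl.mul (Cl.conj (Cl.cxd M.toSAV x)) (f (Cl.moebius M.toSAV x))) :
    ∀ x ∈ Cl.upperHalf (m + 2),
      Cl.dirac F x + (k / x (Fin.last (m + 2))) • Cl.involute (Cl.Qpart (F x)) = 0 := by
  intro x hx
  have hy := M.moebius_mem_upperHalf hx
  have hdiff : DifferentiableAt ℝ f (Cl.moebius M.toSAV x) :=
    (hf.contDiffAt ((Cl.isOpen_upperHalf (m + 2)).mem_nhds hy)).differentiableAt (by simp)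
  have h := M.dirac_add_involute_Qpart_eq_zero hx k hdiff (hmono _ hy)
  have hm : ((m + 1 : ℕ) : ℝ) + 2 - k = (m : ℝ) + 2 + 1 - k := by push_cast; ring
  simp only [Cl.inv_norm_rpow] at hF
  rw [hm] at h
  rw [hF]
  exact h
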